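/- arXiv:1611.05404 — 2 statements merged into one kernel-verified Lean document; each statement's English description precedes it below -/
import Mathlib

section
/- Let n ≥ 1, let M be an n×n integer matrix with det M ≠ 0, let H ⊆ ℕⁿ be a finite set, and let t ≥ 1 be an integer. Then H is a minimum distance diagram of M if and only if the t-dilate tH is a minimum distance diagram of tM. -/
/-- Congruence modulo the lattice `M·ℤⁿ`: `a ≡ b (mod M)` iff `a - b = M·λ` for some `λ ∈ ℤⁿ`. -/
def MEq {n : ℕ} (M : Matrix (Fin n) (Fin n) ℤ) (a b : Fin n → ℤ) : Prop :=
  ∃ l : Fin n → ℤ, a - b = M.mulVec l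

/-- View a vector of naturals as a vector of integers. -/
def ivec {n : ℕ} (a : Fin n → ℕ) : Fin n → ℤ := fun i => (a i : ℤ)

/-- The ℓ¹-norm of a nonnegative integer vector. -/
def nnorm {n : ℕ} (a : Fin n → ℕ) : ℕ := ∑ i, a i

/-- A hyper-L of `M`: a finite lower set of `ℕⁿ` whose reduction map to `ℤⁿ/Mℤⁿ`
is a bijection (every `z ∈ ℤⁿ` is congruent mod `M` to exactly one element of `L`). -/
def IsHyperL {n : ℕ} (M : Matrix (Fin n) (Fin n) ℤ) (L : Set (Fin n → ℕ)) : Prop :=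
  L.Finite ∧ IsLowerSet L ∧ ∀ z : Fin n → ℤ, ∃! a : Fin n → ℕ, a ∈ L ∧ MEq M (ivec a) z

/-- The `t`-dilate of a set `L ⊆ ℕⁿ`:
`tL = {t·a + α : a ∈ L, α ∈ ℕⁿ, αᵢ ≤ t - 1 for all i}`. -/
def dilate {n : ℕ} (t : ℕ) (L : Set (Fin n → ℕ)) : Set (Fin n → ℕ) :=
  {x | ∃ a ∈ L, ∃ α : Fin n → ℕ, (∀ i, α i ≤ t - 1) ∧ x = fun i => t * a i + α i}

/-- The diameter of a set `L ⊆ ℕⁿ`: the maximum ℓ¹-norm of its elements. -/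
noncomputable def kdiam {n : ℕ} (L : Set (Fin n → ℕ)) : ℕ := sSup (nnorm '' L)

/-- The distance from `0` to (the class of) `z` in the Cayley digraph `G_M`:
the minimum ℓ¹-norm of a nonnegative vector congruent to `z` mod `M`. -/
noncomputable def distG {n : ℕ} (M : Matrix (Fin n) (Fin n) ℤ) (z : Fin n → ℤ) : ℕ :=
  sInf {m | ∃ x : Fin n → ℕ, MEq M (ivec x) z ∧ m = nnorm x}

/-- The diameter of the Cayley digraph `G_M = Cay(ℤⁿ/Mℤⁿ, {e₁,…,eₙ})`. -/
noncomputable def kG {n : ℕ} (M : Matrix (Fin n) (Fin n) ℤ) : ℕ :=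
  sSup (Set.range fun z : Fin n → ℤ => distG M z)

/-- A minimum distance diagram of `M`: a hyper-L each of whose elements has
minimum ℓ¹-norm within its congruence class mod `M`. -/
def IsMDD {n : ℕ} (M : Matrix (Fin n) (Fin n) ℤ) (H : Set (Fin n → ℕ)) : Prop :=
  IsHyperL M H ∧ ∀ a ∈ H, ∀ x : Fin n → ℕ, MEq M (ivec x) (ivec a) → nnorm a ≤ nnorm x

theorem mem_dilate_iff {n t : ℕ} (ht : 1 ≤ t) (L : Set (Fin n → ℕ)) (x : Fin n → ℕ) :
    x ∈ dilate t L ↔ (fun i => x i / t) ∈ L := by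
  constructor
  · rintro ⟨a, ha, α, hα, rfl⟩
    convert ha using 2 with i
    rw [Nat.mul_add_div (by omega), Nat.div_eq_of_lt (by have := hα i; omega), add_zero]
  · intro h
    refine ⟨_, h, fun i => x i % t, fun i => ?_, ?_⟩
    · have := Nat.mod_lt (x i) (show 0 < t by omega)
      dsimp only
      omega
    · funext i
      exact (Nat.div_add_mod _ _).symm

theorem mul_mem_dilate_iff {n t : ℕ} (ht : 1 ≤ t) (L : Set (Fin n → ℕ)) (a : Fin n → ℕ) :
    (fun i => t * a i) ∈ dilate t L ↔ a ∈ L := by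
  have h : ∀ i, t * a i / t = a i := fun i => Nat.mul_div_cancel_left _ (by omega)
  simp only [mem_dilate_iff ht, h]

theorem dilate_finite {n t : ℕ} {L : Set (Fin n → ℕ)} (hL : L.Finite) : (dilate t L).Finite := by
  refine (hL.image2 (fun a α i => t * a i + α i)
    (Set.finite_Iic (fun _ : Fin n => t - 1))).subset ?_
  rintro x ⟨a, ha, α, hα, rfl⟩
  exact ⟨a, ha, α, hα, rfl⟩

/-- Congruence modulo `tM` amounts to equality of remainders modulo `t` together with congruence
of quotients modulo `M`. -/
theorem mEq_smul_iff {n t : ℕ} (ht : 1 ≤ t) (M : Matrix (Fin n) (Fin n) ℤ) (x z : Fin n → ℤ) :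
    MEq ((t : ℤ) • M) x z ↔
      (∀ i, x i % t = z i % t) ∧ MEq M (fun i => x i / t) (fun i => z i / t) := by
  have ht' : (t : ℤ) ≠ 0 := by omega
  constructor
  · rintro ⟨l, hl⟩
    have key : ∀ i, x i = z i + t * M.mulVec l i := fun i => by
      have := congrFun hl i
      simp only [Matrix.smul_mulVec, Pi.sub_apply, Pi.smul_apply, smul_eq_mul] at this
      linarith
    refine ⟨fun i => by rw [key i, Int.add_mul_emod_self_left], l, ?_⟩
    funext i
    simp only [Pi.sub_apply]
    rw [key i, Int.add_mul_ediv_left _ _ ht']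
    ring
  · rintro ⟨hmod, l, hl⟩
    refine ⟨l, ?_⟩
    funext i
    have h := congrFun hl i
    simp only [Pi.sub_apply] at h
    simp only [Matrix.smul_mulVec, Pi.sub_apply, Pi.smul_apply, smul_eq_mul, ← h]
    linarith [Int.mul_ediv_add_emod (x i) t, Int.mul_ediv_add_emod (z i) t, hmod i]

theorem mEq_smul_mul_iff {n t : ℕ} (ht : 1 ≤ t) (M : Matrix (Fin n) (Fin n) ℤ) (x z : Fin n → ℤ) :
    MEq ((t : ℤ) • M) (fun i => t * x i) (fun i => t * z i) ↔ MEq M x z := by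
  have h : ∀ a : ℤ, t * a / t = a := fun a => Int.mul_ediv_cancel_left _ (by omega)
  rw [mEq_smul_iff ht]
  simp [h]

theorem ivec_mul {n : ℕ} (t : ℕ) (a : Fin n → ℕ) :
    ivec (fun i => t * a i) = fun i => (t : ℤ) * ivec a i := by
  funext i
  simp [ivec]

theorem mEq_smul_ivec_iff {n t : ℕ} (ht : 1 ≤ t) (M : Matrix (Fin n) (Fin n) ℤ)
    (x : Fin n → ℕ) (z : Fin n → ℤ) :
    MEq ((t : ℤ) • M) (ivec x) z ↔
      (∀ i, ((x i % t : ℕ) : ℤ) = z i % t) ∧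
        MEq M (ivec fun i => x i / t) (fun i => z i / t) :=
  mEq_smul_iff ht M (ivec x) z

theorem nnorm_mul {n : ℕ} (t : ℕ) (a : Fin n → ℕ) :
    nnorm (fun i => t * a i) = t * nnorm a :=
  (Finset.mul_sum _ _ _).symm

theorem nnorm_div_add_mod {n : ℕ} (t : ℕ) (x : Fin n → ℕ) :
    t * nnorm (fun i => x i / t) + nnorm (fun i => x i % t) = nnorm x := by
  simp only [nnorm, Finset.mul_sum, ← Finset.sum_add_distrib, Nat.div_add_mod]

theorem IsHyperL.dilate {n t : ℕ} (ht : 1 ≤ t) {M : Matrix (Fin n) (Fin n) ℤ}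
    {L : Set (Fin n → ℕ)} (h : IsHyperL M L) : IsHyperL ((t : ℤ) • M) (dilate t L) := by
  obtain ⟨hfin, hlow, hbij⟩ := h
  refine ⟨dilate_finite hfin, fun x y hyx hx => ?_, fun z => ?_⟩
  · rw [mem_dilate_iff ht] at hx ⊢
    exact hlow (fun i => Nat.div_le_div_right (hyx i)) hx
  · obtain ⟨a, ⟨haL, ha⟩, huniq⟩ := hbij fun i => z i / t
    have hpos : (0 : ℤ) < t := by omega
    have hlt : ∀ i, (z i % t).toNat < t := fun i => by
      have := Int.emod_lt_of_pos (z i) hpos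
      omega
    have hdiv : ∀ i, (t * a i + (z i % t).toNat) / t = a i := fun i => by
      rw [Nat.mul_add_div (by omega), Nat.div_eq_of_lt (hlt i), add_zero]
    have hmod : ∀ i, (t * a i + (z i % t).toNat) % t = (z i % t).toNat := fun i => by
      rw [Nat.mul_add_mod, Nat.mod_eq_of_lt (hlt i)]
    refine ⟨fun i => t * a i + (z i % t).toNat, ⟨?_, ?_⟩, ?_⟩
    · rw [mem_dilate_iff ht]
      simpa only [hdiv] using haL
    · rw [mEq_smul_ivec_iff ht]
      simp only [hdiv, hmod]
      exact ⟨fun i => Int.toNat_of_nonneg (Int.emod_nonneg _ hpos.ne'), ha⟩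
    · rintro y ⟨hyL, hy⟩
      rw [mem_dilate_iff ht] at hyL
      rw [mEq_smul_ivec_iff ht] at hy
      have hya := huniq _ ⟨hyL, hy.2⟩
      funext i
      rw [← congrFun hya i, ← hy.1 i, Int.toNat_natCast, Nat.div_add_mod]

theorem IsHyperL.of_dilate {n t : ℕ} (ht : 1 ≤ t) {M : Matrix (Fin n) (Fin n) ℤ}
    {L : Set (Fin n → ℕ)} (hfin : L.Finite) (h : IsHyperL ((t : ℤ) • M) (_root_.dilate t L)) :
    IsHyperL M L := by
  obtain ⟨-, hlow, hbij⟩ := h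
  refine ⟨hfin, fun a b hba ha => ?_, fun z => ?_⟩
  · rw [← mul_mem_dilate_iff ht] at ha ⊢
    exact hlow (fun i => Nat.mul_le_mul_left t (hba i)) ha
  · obtain ⟨x, ⟨hxL, hx⟩, huniq⟩ := hbij fun i => t * z i
    have hdiv : ∀ i, (t : ℤ) * z i / t = z i := fun i => Int.mul_ediv_cancel_left _ (by omega)
    refine ⟨fun i => x i / t, ⟨(mem_dilate_iff ht _ _).1 hxL, ?_⟩, ?_⟩
    · simpa only [hdiv] using ((mEq_smul_ivec_iff ht _ _ _).1 hx).2
    · rintro b ⟨hbL, hb⟩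
      have hbx := huniq (fun i => t * b i)
        ⟨(mul_mem_dilate_iff ht _ _).2 hbL, by rwa [ivec_mul, mEq_smul_mul_iff ht]⟩
      funext i
      rw [← congrFun hbx i, Nat.mul_div_cancel_left _ (by omega)]

/-- Theorem, part (c): a finite set `H ⊆ ℕⁿ` is a minimum distance
diagram of `M` iff its `t`-dilate is a minimum distance diagram of `tM`. -/
theorem isMDD_iff_dilate {n : ℕ} (hn : 1 ≤ n) (M : Matrix (Fin n) (Fin n) ℤ)
    (hM : M.det ≠ 0) (H : Set (Fin n → ℕ)) (hfin : H.Finite) (t : ℕ) (ht : 1 ≤ t) :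
    IsMDD M H ↔ IsMDD ((t : ℤ) • M) (dilate t H) := by
  constructor
  · rintro ⟨hL, hmin⟩
    refine ⟨hL.dilate ht, fun x hx y hyx => ?_⟩
    rw [mem_dilate_iff ht] at hx
    obtain ⟨hmod, hdiv⟩ := (mEq_smul_ivec_iff ht _ _ _).1 hyx
    have hmod' : (fun i => y i % t) = fun i => x i % t := by
      funext i
      exact Int.natCast_inj.1 (hmod i)
    have hle := hmin _ hx (fun i => y i / t) hdiv
    rw [← nnorm_div_add_mod t x, ← nnorm_div_add_mod t y, hmod']
    gcongr
  · rintro ⟨hL, hmin⟩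
    refine ⟨hL.of_dilate ht hfin, fun a ha x hxa => ?_⟩
    have hle := hmin _ ((mul_mem_dilate_iff ht _ _).2 ha) (fun i => t * x i)
      (by rwa [ivec_mul, ivec_mul, mEq_smul_mul_iff ht])
    rw [nnorm_mul, nnorm_mul] at hle
    exact Nat.le_of_mul_le_mul_left hle ht
end

section
/- Let n ≥ 1, let M be an n×n integer matrix with det M ≠ 0, and let t ≥ 1 be an integer. Then the densities of G_{tM} and G_M coincide: |det(tM)| / (k(G_{tM}) + n)ⁿ = |det M| / (k(G_M) + n)ⁿ as rational numbers. -/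
theorem MEq.exists_nat_bounded {n : ℕ} (M : Matrix (Fin n) (Fin n) ℤ) (hM : M.det ≠ 0)
    (z : Fin n → ℤ) :
    ∃ x : Fin n → ℕ, MEq M (ivec x) z ∧ nnorm x ≤ n * M.det.natAbs := by
  have hx (i : Fin n) : ((z i % M.det).toNat : ℤ) = z i % M.det :=
    Int.toNat_of_nonneg (Int.emod_nonneg _ hM)
  refine ⟨fun i => (z i % M.det).toNat, ⟨M.adjugate.mulVec fun i => -(z i / M.det), ?_⟩, ?_⟩
  · rw [Matrix.mulVec_mulVec, Matrix.mul_adjugate, Matrix.smul_mulVec, Matrix.one_mulVec]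
    ext i
    simp only [ivec, Pi.sub_apply, Pi.smul_apply, smul_eq_mul, hx]
    linarith [Int.emod_add_mul_ediv (z i) M.det]
  · calc nnorm (fun i => (z i % M.det).toNat) ≤ ∑ _i : Fin n, M.det.natAbs :=
          Finset.sum_le_sum fun i _ => by
            have := Int.emod_lt (z i) hM
            have := hx i
            omega
      _ = n * M.det.natAbs := by simp

/-- The distance is attained by a nonnegative representative. -/
theorem exists_nnorm_eq_distG {n : ℕ} (M : Matrix (Fin n) (Fin n) ℤ) (hM : M.det ≠ 0)
    (z : Fin n → ℤ) : ∃ x : Fin n → ℕ, MEq M (ivec x) z ∧ distG M z = nnorm x := by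
  obtain ⟨x, hx, -⟩ := MEq.exists_nat_bounded M hM z
  exact Nat.sInf_mem (s := {m | ∃ x : Fin n → ℕ, MEq M (ivec x) z ∧ m = nnorm x}) ⟨_, x, hx, rfl⟩

theorem distG_le_nnorm {n : ℕ} {M : Matrix (Fin n) (Fin n) ℤ} {z : Fin n → ℤ} {x : Fin n → ℕ}
    (hx : MEq M (ivec x) z) : distG M z ≤ nnorm x :=
  Nat.sInf_le ⟨x, hx, rfl⟩

theorem isGreatest_kG {n : ℕ} (M : Matrix (Fin n) (Fin n) ℤ) (hM : M.det ≠ 0) :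
    IsGreatest (Set.range (distG M)) (kG M) := by
  have hb : BddAbove (Set.range (distG M)) := by
    refine ⟨n * M.det.natAbs, ?_⟩
    rintro _ ⟨z, rfl⟩
    obtain ⟨x, hx, hle⟩ := MEq.exists_nat_bounded M hM z
    exact (distG_le_nnorm hx).trans hle
  exact ⟨Nat.sSup_mem (Set.range_nonempty _) hb, fun _ h => le_csSup hb h⟩

theorem nnorm_dilate {n : ℕ} (t : ℕ) (y α : Fin n → ℕ) :
    nnorm (fun i => t * y i + α i) = t * nnorm y + nnorm α := by
  simp only [nnorm, Finset.sum_add_distrib, Finset.mul_sum]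

/-- Congruence mod `tM` of vectors with the same residue mod `t` is congruence mod `M` of the
quotients. -/
theorem MEq_smul_iff {n : ℕ} (M : Matrix (Fin n) (Fin n) ℤ) {t : ℕ} (ht : 1 ≤ t)
    (y α : Fin n → ℕ) (z : Fin n → ℤ) :
    MEq ((t : ℤ) • M) (ivec fun i => t * y i + α i) (fun i => t * z i + α i) ↔
      MEq M (ivec y) z := by
  have ht0 : (t : ℤ) ≠ 0 := by omega
  refine exists_congr fun l => ?_
  simp only [funext_iff, Matrix.smul_mulVec, Pi.smul_apply, Pi.sub_apply, smul_eq_mul, ivec]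
  refine forall_congr' fun i => ?_
  rw [← mul_right_inj' ht0 (b := (y i : ℤ) - z i)]
  push_cast
  ring_nf

/-- A nonnegative vector congruent to `tz + α` mod `tM` has residue `α` mod `t`. -/
theorem MEq.exists_eq_dilate {n : ℕ} {M : Matrix (Fin n) (Fin n) ℤ} {t : ℕ} {x α : Fin n → ℕ}
    (hα : ∀ i, α i < t) {z : Fin n → ℤ}
    (hx : MEq ((t : ℤ) • M) (ivec x) (fun i => t * z i + α i)) :
    ∃ y : Fin n → ℕ, x = fun i => t * y i + α i := by
  obtain ⟨l, hl⟩ := hx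
  refine ⟨fun i => x i / t, funext fun i => ?_⟩
  have h := congrFun hl i
  simp only [Matrix.smul_mulVec, Pi.smul_apply, Pi.sub_apply, smul_eq_mul, ivec] at h
  have hmod : (x i : ℤ) % t = α i := by
    have hxi : (x i : ℤ) = α i + t * (z i + M.mulVec l i) := by linarith
    rw [hxi, Int.add_mul_emod_self_left, Int.emod_eq_of_lt (by positivity)]
    exact_mod_cast hα i
  have hmod' : x i % t = α i := by exact_mod_cast hmod
  rw [← hmod', Nat.div_add_mod]

theorem det_natCast_smul_ne_zero {n : ℕ} {M : Matrix (Fin n) (Fin n) ℤ} (hM : M.det ≠ 0) {t : ℕ}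
    (ht : 1 ≤ t) : ((t : ℤ) • M).det ≠ 0 := by
  rw [Matrix.det_smul]
  exact mul_ne_zero (pow_ne_zero _ (by omega)) hM

theorem distG_smul {n : ℕ} (M : Matrix (Fin n) (Fin n) ℤ) (hM : M.det ≠ 0) {t : ℕ} (ht : 1 ≤ t)
    (z : Fin n → ℤ) {α : Fin n → ℕ} (hα : ∀ i, α i < t) :
    distG ((t : ℤ) • M) (fun i => t * z i + α i) = t * distG M z + nnorm α := by
  apply le_antisymm
  · obtain ⟨y, hy, hd⟩ := exists_nnorm_eq_distG M hM z
    rw [hd, ← nnorm_dilate]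
    exact distG_le_nnorm ((MEq_smul_iff M ht y α z).2 hy)
  · obtain ⟨x, hx, hd⟩ := exists_nnorm_eq_distG _ (det_natCast_smul_ne_zero hM ht)
      (fun i => t * z i + α i)
    obtain ⟨y, rfl⟩ := hx.exists_eq_dilate hα
    rw [hd, nnorm_dilate]
    gcongr
    exact distG_le_nnorm ((MEq_smul_iff M ht y α z).1 hx)

theorem kG_smul_add {n : ℕ} (M : Matrix (Fin n) (Fin n) ℤ) (hM : M.det ≠ 0) {t : ℕ}
    (ht : 1 ≤ t) : kG ((t : ℤ) • M) + n = t * (kG M + n) := by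
  have htM := isGreatest_kG _ (det_natCast_smul_ne_zero hM ht)
  suffices h : kG ((t : ℤ) • M) = t * kG M + n * (t - 1) by
    obtain ⟨s, rfl⟩ := Nat.exists_eq_add_of_le' ht
    rw [h, Nat.add_sub_cancel]
    ring
  apply le_antisymm
  · obtain ⟨w, hw⟩ := htM.1
    have ht0 : (0 : ℤ) < t := by omega
    have hr (i : Fin n) : ((w i % t).toNat : ℤ) = w i % t :=
      Int.toNat_of_nonneg (Int.emod_nonneg _ ht0.ne')
    have hα (i : Fin n) : (w i % t).toNat < t := by
      have := Int.emod_lt_of_pos (w i) ht0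
      have := hr i
      omega
    have hdecomp : w = fun i => (t : ℤ) * (w i / t) + ((w i % t).toNat : ℕ) :=
      funext fun i => by rw [hr, Int.mul_ediv_add_emod]
    rw [← hw, hdecomp, distG_smul M hM ht (fun i => w i / t) hα]
    gcongr
    · exact (isGreatest_kG M hM).2 ⟨_, rfl⟩
    · calc nnorm (fun i => (w i % t).toNat) ≤ ∑ _i : Fin n, (t - 1) :=
            Finset.sum_le_sum fun i _ => Nat.le_sub_one_of_lt (hα i)
        _ = n * (t - 1) := by simp
  · obtain ⟨z, hz⟩ := (isGreatest_kG M hM).1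
    have hd := distG_smul M hM ht z (α := fun _ => t - 1) fun _ => by omega
    have hsum : nnorm (fun _ : Fin n => t - 1) = n * (t - 1) := by simp [nnorm]
    rw [hz, hsum] at hd
    exact hd ▸ htM.2 ⟨_, rfl⟩

/-- the densities of `G_{tM}` and `G_M` coincide:
`|det(tM)| / (k(G_{tM}) + n)ⁿ = |det M| / (k(G_M) + n)ⁿ` as rational numbers. -/
theorem density_smul {n : ℕ} (hn : 1 ≤ n) (M : Matrix (Fin n) (Fin n) ℤ)
    (hM : M.det ≠ 0) (t : ℕ) (ht : 1 ≤ t) :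
    ((((t : ℤ) • M).det.natAbs : ℚ)) / ((kG ((t : ℤ) • M) : ℚ) + n) ^ n
      = ((M.det.natAbs : ℚ)) / ((kG M : ℚ) + n) ^ n := by
  have hk : (kG ((t : ℤ) • M) : ℚ) + n = t * (kG M + n) := by exact_mod_cast kG_smul_add M hM ht
  have ht0 : (t : ℚ) ^ n ≠ 0 := pow_ne_zero _ (by positivity)
  rw [hk, Matrix.det_smul, Fintype.card_fin, Int.natAbs_mul, Int.natAbs_pow, Int.natAbs_natCast,
    Nat.cast_mul, Nat.cast_pow, mul_pow, mul_div_mul_left _ _ ht0]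
end
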